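/- For every n ≥ 1 there is an isomorphism of F_p-algebras from the (n+1)-fold tensor product F_p[x^{1/p^∞}] ⊗_{F_p[x]} ⋯ ⊗_{F_p[x]} F_p[x^{1/p^∞}] to F_p[x^{1/p^∞}] ⊗_{F_p} (F_p[y^{1/p^∞}]/(y))^{⊗_{F_p} n}, under which, writing x_i^{1/p^k} for the pure tensor with x^{1/p^k} in the i-th slot and 1 elsewhere (1 ≤ i ≤ n+1), the element x_i^{1/p^k} − x_{i+1}^{1/p^k} corresponds to the element 1 ⊗ ȳ^{1/p^k} placed in the i-th quotient factor (1 ≤ i ≤ n, k ∈ ℕ). -/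

import Mathlib

set_option synthInstance.maxHeartbeats 1000000
set_option maxHeartbeats 1000000

open scoped TensorProduct
open PiTensorProduct

/-- The additive monoid `M = ℤ[1/p]_{≥ 0}` of nonnegative rational numbers whose
denominator is a power of `p`, realized as an additive submonoid of `ℚ`. -/
def Mp (p : ℕ) : AddSubmonoid ℚ where
  carrier := {q | 0 ≤ q ∧ ∃ (k : ℕ) (m : ℤ), q * (p : ℚ) ^ k = m}
  zero_mem' := ⟨le_refl 0, 0, 0, by norm_num⟩
  add_mem' := by
    rintro a b ⟨ha, k, m, hm⟩ ⟨hb, l, n, hn⟩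
    refine ⟨add_nonneg ha hb, k + l, m * (p : ℤ) ^ l + n * (p : ℤ) ^ k, ?_⟩
    push_cast
    calc (a + b) * (p : ℚ) ^ (k + l)
        = (a * (p : ℚ) ^ k) * (p : ℚ) ^ l + (b * (p : ℚ) ^ l) * (p : ℚ) ^ k := by
          rw [pow_add]; ring
      _ = (m : ℚ) * (p : ℚ) ^ l + (n : ℚ) * (p : ℚ) ^ k := by rw [hm, hn]

/-- `F_p[x^{1/p^∞}]` (equally, `F_p[y^{1/p^∞}]`): the monoid algebra of `M` over
`F_p = ZMod p`. -/
abbrev Rp (p : ℕ) : Type := AddMonoidAlgebra (ZMod p) (Mp p)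

/-- The basis element `x^q` (resp. `y^q`), for `q ∈ M`. -/
noncomputable def xe (p : ℕ) (q : Mp p) : Rp p := AddMonoidAlgebra.single q 1

/-- `1 ∈ M`. -/
def oneM (p : ℕ) : Mp p := ⟨1, zero_le_one, 0, 1, by norm_num⟩

/-- `1/p^k ∈ M`. -/
def pinvM (p : ℕ) (hp : p ≠ 0) (k : ℕ) : Mp p :=
  ⟨1 / (p : ℚ) ^ k, by positivity, k, 1, by
    have hp' : (p : ℚ) ≠ 0 := Nat.cast_ne_zero.mpr hp
    field_simp
    norm_num⟩

/-- The quotient ring `F_p[y^{1/p^∞}]/(y)`. -/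
abbrev Ap (p : ℕ) : Type := Rp p ⧸ Ideal.span {xe p (oneM p)}

/-- The class `ȳ^q` of the basis element `y^q` in `F_p[y^{1/p^∞}]/(y)`. -/
noncomputable def ybar (p : ℕ) (q : Mp p) : Ap p :=
  Ideal.Quotient.mk (Ideal.span {xe p (oneM p)}) (xe p q)

/-- `F_p[x^{1/p^∞}]` as an `F_p[x]`-algebra via `x ↦ x^1`. -/
noncomputable instance (p : ℕ) : Algebra (Polynomial (ZMod p)) (Rp p) :=
  (Polynomial.aeval (xe p (oneM p))).toRingHom.toAlgebra

instance (p : ℕ) : IsScalarTower (ZMod p) (Polynomial (ZMod p)) (Rp p) :=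
  IsScalarTower.of_algebraMap_eq' (by
    rw [RingHom.algebraMap_toAlgebra]
    exact ((Polynomial.aeval (xe p (oneM p))).comp_algebraMap).symm)

/-- The family of factors of `F_p[x^{1/p^∞}] ⊗_{F_p} (F_p[y^{1/p^∞}]/(y))^{⊗_{F_p} n}`:
the factor indexed by `none` is `F_p[x^{1/p^∞}]`, and the factors indexed by
`some i`, `i : Fin n`, are the `n` copies of `F_p[y^{1/p^∞}]/(y)`. -/
def Bfac (p n : ℕ) : Option (Fin n) → Type
  | none => Rp p
  | some _ => Ap p

noncomputable instance (p n : ℕ) (o : Option (Fin n)) : CommRing (Bfac p n o) :=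
  match o with
  | none => inferInstanceAs (CommRing (Rp p))
  | some _ => inferInstanceAs (CommRing (Ap p))

noncomputable instance (p n : ℕ) (o : Option (Fin n)) : Algebra (ZMod p) (Bfac p n o) :=
  match o with
  | none => inferInstanceAs (Algebra (ZMod p) (Rp p))
  | some _ => inferInstanceAs (Algebra (ZMod p) (Ap p))

/-- `F_p[x^{1/p^∞}] ⊗_{F_p} (F_p[y^{1/p^∞}]/(y))^{⊗_{F_p} n}`, as the tensor product
over `F_p` of the family `Bfac`. -/
abbrev targetAlg (p n : ℕ) : Type := ⨂[ZMod p] o : Option (Fin n), Bfac p n o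

/-- The pure tensor `x_i^{1/p^k}` in the `(n+1)`-fold tensor product
`F_p[x^{1/p^∞}] ⊗_{F_p[x]} ⋯ ⊗_{F_p[x]} F_p[x^{1/p^∞}]`, having `x^{1/p^k}` in the
`i`-th slot and `1` elsewhere. -/
noncomputable def xSlot (p : ℕ) (hp : p ≠ 0) (n : ℕ) (i : Fin (n + 1)) (k : ℕ) :
    ⨂[Polynomial (ZMod p)] (_ : Fin (n + 1)), Rp p :=
  tprod (Polynomial (ZMod p)) (Function.update (fun _ => (1 : Rp p)) i (xe p (pinvM p hp k)))

/-- The pure tensor `1 ⊗ ȳ^{1/p^k}` in `F_p[x^{1/p^∞}] ⊗_{F_p} (F_p[y^{1/p^∞}]/(y))^{⊗ n}`,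
with `ȳ^{1/p^k}` placed in the `i`-th quotient factor. -/
noncomputable def ySlot (p : ℕ) (hp : p ≠ 0) (n : ℕ) (i : Fin n) (k : ℕ) : targetAlg p n :=
  tprod (ZMod p)
    (Function.update (fun o => (1 : Bfac p n o)) (some i) (ybar p (pinvM p hp k)))

section PiTensor

variable {ι R S : Type*} {A : ι → Type*} [Fintype ι] [DecidableEq ι] [CommRing R]
  [∀ i, CommRing (A i)] [∀ i, Algebra R (A i)] [CommRing S]

/-- A family of algebra homomorphisms into a commutative algebra induces one on the finite
tensor product. -/
lemma exists_algHom_piTensorProduct [Algebra R S] (f : ∀ i, A i →ₐ[R] S) :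
    ∃ F : (⨂[R] i, A i) →ₐ[R] S,
      ∀ i (a : A i), F (tprod R (Function.update (fun _ => 1) i a)) = f i a := by
  refine ⟨liftAlgHom ((MultilinearMap.mkPiAlgebra R ι S).compLinearMap
    fun i => (f i).toLinearMap) (by simp) (by simp [Finset.prod_mul_distrib]), fun i a => ?_⟩
  refine (lift.tprod _).trans ?_
  rw [MultilinearMap.compLinearMap_apply, MultilinearMap.mkPiAlgebra_apply,
    Finset.prod_eq_single i]
  · simp
  · intro j _ hj
    simp [Function.update_of_ne hj]
  · simp

/-- Ring homomorphisms out of a nonempty finite tensor product are determined by their values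
on the factors. -/
lemma piTensorProduct_ringHom_ext [Nonempty ι] {f g : (⨂[R] i, A i) →+* S}
    (h : ∀ i (a : A i), f (tprod R (Function.update (fun _ => 1) i a)) =
      g (tprod R (Function.update (fun _ => 1) i a))) : f = g := by
  have key : ∀ x : Π i, A i, f (tprod R x) = g (tprod R x) := by
    have : (f : (⨂[R] i, A i) →* S).comp (tprodMonoidHom R) =
        (g : (⨂[R] i, A i) →* S).comp (tprodMonoidHom R) :=
      MonoidHom.pi_ext fun i a => h i a
    exact fun x => DFunLike.congr_fun this x
  ext z
  induction z using PiTensorProduct.induction_on with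
  | smul_tprod r x =>
    obtain ⟨i⟩ := ‹Nonempty ι›
    rw [Algebra.smul_def, algebraMap_apply r i, map_mul, map_mul, key, key]
  | add x y hx hy => rw [map_add, map_add, hx, hy]

end PiTensor

section Roots

variable {p : ℕ} {S : Type*} [CommRing S] [Algebra (ZMod p) S]

lemma sub_pow_of_zmod_algebra (hp : p.Prime) (a b : S) : (a - b) ^ p = a ^ p - b ^ p := by
  have := Fact.mk hp
  cases subsingleton_or_nontrivial S
  · exact Subsingleton.elim _ _
  · have : CharP S p := charP_of_injective_algebraMap (algebraMap (ZMod p) S).injective p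
    exact sub_pow_char a b

lemma xe_pow (q : Mp p) (m : ℕ) : xe p q ^ m = xe p (m • q) := by
  simp [xe, AddMonoidAlgebra.single_pow]

lemma pinvM_zero (hp : p ≠ 0) : pinvM p hp 0 = oneM p :=
  Subtype.ext (by simp [pinvM, oneM])

lemma xe_pinvM_succ_pow (hp : p ≠ 0) (k : ℕ) :
    xe p (pinvM p hp (k + 1)) ^ p = xe p (pinvM p hp k) := by
  rw [xe_pow]
  congr 1
  refine Subtype.ext ?_
  have : (p : ℚ) ≠ 0 := Nat.cast_ne_zero.mpr hp
  simp only [pinvM, AddSubmonoidClass.coe_nsmul, nsmul_eq_mul]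
  field_simp
  ring

lemma Mp.exists_nat (hp : p ≠ 0) (q : Mp p) : ∃ k m : ℕ, (q : ℚ) * (p : ℚ) ^ k = m := by
  obtain ⟨q, hq, k, m, hm⟩ := q
  have hm0 : (0 : ℚ) ≤ m := by rw [← hm]; positivity
  lift m to ℕ using by exact_mod_cast hm0
  exact ⟨k, m, by simpa using hm⟩

lemma Mp.eq_nsmul (hp : p ≠ 0) {q : Mp p} {k m : ℕ} (h : (q : ℚ) * (p : ℚ) ^ k = m) :
    q = m • pinvM p hp k := by
  refine Subtype.ext ?_
  have : (p : ℚ) ≠ 0 := Nat.cast_ne_zero.mpr hp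
  simp only [pinvM, AddSubmonoidClass.coe_nsmul, nsmul_eq_mul, ← h]
  field_simp

/-- Algebra homomorphisms out of `F_p[x^{1/p^∞}]` are determined by the images of the
`x^{1/p^k}`. -/
lemma Rp_algHom_ext (hp : p ≠ 0) {f g : Rp p →ₐ[ZMod p] S}
    (h : ∀ k, f (xe p (pinvM p hp k)) = g (xe p (pinvM p hp k))) : f = g := by
  have key (q : Mp p) : f (xe p q) = g (xe p q) := by
    obtain ⟨k, m, hk⟩ := Mp.exists_nat hp q
    rw [Mp.eq_nsmul hp hk, ← xe_pow, map_pow, map_pow, h]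
  refine AddMonoidAlgebra.algHom_ext' ?_ (by ext)
  ext q
  exact key q

/-- A compatible system of `p`-power roots defines an algebra homomorphism out of
`F_p[x^{1/p^∞}]`. -/
lemma exists_Rp_algHom (hp : p ≠ 0) (s : ℕ → S) (hs : ∀ k, s (k + 1) ^ p = s k) :
    ∃ f : Rp p →ₐ[ZMod p] S, ∀ k, f (xe p (pinvM p hp k)) = s k := by
  have hp' : (p : ℚ) ≠ 0 := Nat.cast_ne_zero.mpr hp
  have hs' (k l : ℕ) : s (k + l) ^ p ^ l = s k := by
    induction l with
    | zero => simp
    | succ l ih => rw [pow_succ', pow_mul, ← add_assoc, hs, ih]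
  have hval (q : Mp p) : ∃ a : S, ∀ k m : ℕ, (q : ℚ) * (p : ℚ) ^ k = m → a = s k ^ m := by
    obtain ⟨l, n, hl⟩ := Mp.exists_nat hp q
    refine ⟨s l ^ n, fun k m hk => ?_⟩
    have : n * p ^ k = m * p ^ l := by
      have : (n : ℚ) * (p : ℚ) ^ k = m * (p : ℚ) ^ l := by rw [← hl, ← hk]; ring
      exact_mod_cast this
    rw [← hs' l k, ← hs' k l, ← pow_mul, ← pow_mul, mul_comm, this, add_comm l k, mul_comm]
  choose v hv using hval
  let F : Multiplicative (Mp p) →* S :=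
    { toFun := fun q => v q.toAdd
      map_one' := by rw [hv _ 0 0 (by simp), pow_zero]
      map_mul' := fun a b => by
        obtain ⟨k, m, hk⟩ := Mp.exists_nat hp a.toAdd
        obtain ⟨l, n, hl⟩ := Mp.exists_nat hp b.toAdd
        rw [hv _ (k + l) (m * p ^ l + n * p ^ k), hv _ (k + l) (m * p ^ l),
          hv _ (k + l) (n * p ^ k), pow_add]
        · push_cast [← hl]; ring
        · push_cast [← hk]; ring
        · push_cast [← hl, ← hk, toAdd_mul]; ring }
  refine ⟨AddMonoidAlgebra.lift (ZMod p) S (Mp p) F, fun k => ?_⟩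
  rw [xe, AddMonoidAlgebra.lift_single, one_smul]
  exact (hv (pinvM p hp k) k 1 (by simp [pinvM, hp'])).trans (pow_one _)

/-- A compatible system of `p`-power roots of `0` defines an algebra homomorphism out of
`F_p[y^{1/p^∞}]/(y)`. -/
lemma exists_Ap_algHom (hp : p ≠ 0) (s : ℕ → S) (hs : ∀ k, s (k + 1) ^ p = s k)
    (h0 : s 0 = 0) : ∃ f : Ap p →ₐ[ZMod p] S, ∀ k, f (ybar p (pinvM p hp k)) = s k := by
  obtain ⟨f, hf⟩ := exists_Rp_algHom hp s hs
  refine ⟨Ideal.Quotient.liftₐ _ f fun a ha => ?_, hf⟩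
  have hle : Ideal.span {xe p (oneM p)} ≤ RingHom.ker f := by
    rw [Ideal.span_singleton_le_iff_mem, RingHom.mem_ker, ← pinvM_zero hp, hf, h0]
  exact hle ha

lemma Ap_algHom_ext (hp : p ≠ 0) {f g : Ap p →ₐ[ZMod p] S}
    (h : ∀ k, f (ybar p (pinvM p hp k)) = g (ybar p (pinvM p hp k))) : f = g :=
  Ideal.Quotient.algHom_ext _ (Rp_algHom_ext hp h)

lemma ybar_pinvM_succ_pow (hp : p ≠ 0) (k : ℕ) :
    ybar p (pinvM p hp (k + 1)) ^ p = ybar p (pinvM p hp k) := by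
  rw [ybar, ← map_pow, xe_pinvM_succ_pow, ybar]

lemma ybar_pinvM_zero (hp : p ≠ 0) : ybar p (pinvM p hp 0) = 0 := by
  rw [ybar, pinvM_zero, Ideal.Quotient.eq_zero_iff_mem]
  exact Ideal.mem_span_singleton_self _

end Roots

section Source

variable {p n : ℕ}

/-- The inclusion of the `i`-th factor of the `(n+1)`-fold tensor product over `F_p[x]`. -/
noncomputable def sourceIncl (p n : ℕ) (i : Fin (n + 1)) :
    Rp p →ₐ[ZMod p] ⨂[Polynomial (ZMod p)] (_ : Fin (n + 1)), Rp p :=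
  (singleAlgHom (R := Polynomial (ZMod p)) (A := fun _ : Fin (n + 1) => Rp p) i).restrictScalars
    (ZMod p)

lemma xSlot_eq (hp : p ≠ 0) (i : Fin (n + 1)) (k : ℕ) :
    xSlot p hp n i k = sourceIncl p n i (xe p (pinvM p hp k)) := rfl

lemma algebraMap_Rp_X : algebraMap (Polynomial (ZMod p)) (Rp p) Polynomial.X = xe p (oneM p) :=
  Polynomial.aeval_X _

lemma xSlot_zero_eq (hp : p ≠ 0) (i j : Fin (n + 1)) : xSlot p hp n i 0 = xSlot p hp n j 0 := by
  have (i : Fin (n + 1)) : xSlot p hp n i 0 = algebraMap (Polynomial (ZMod p)) _ Polynomial.X := by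
    rw [xSlot_eq, pinvM_zero, ← algebraMap_Rp_X]
    exact (singleAlgHom (R := Polynomial (ZMod p)) (A := fun _ : Fin (n + 1) => Rp p) i).commutes _
  rw [this, this]

lemma xSlot_succ_pow (hp : p ≠ 0) (i : Fin (n + 1)) (k : ℕ) :
    xSlot p hp n i (k + 1) ^ p = xSlot p hp n i k := by
  rw [xSlot_eq, ← map_pow, xe_pinvM_succ_pow, xSlot_eq]

variable {S : Type*} [CommRing S] [Algebra (ZMod p) S]

lemma exists_source_algHom (f : Fin (n + 1) → Rp p →ₐ[ZMod p] S) (t : S)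
    (ht : ∀ i, f i (xe p (oneM p)) = t) :
    ∃ F : (⨂[Polynomial (ZMod p)] (_ : Fin (n + 1)), Rp p) →ₐ[ZMod p] S,
      ∀ i a, F (sourceIncl p n i a) = f i a := by
  let : Algebra (Polynomial (ZMod p)) S := (Polynomial.aeval t).toRingHom.toAlgebra
  have : IsScalarTower (ZMod p) (Polynomial (ZMod p)) S :=
    IsScalarTower.of_algebraMap_eq' (Polynomial.aeval t).comp_algebraMap.symm
  obtain ⟨F, hF⟩ := exists_algHom_piTensorProduct (R := Polynomial (ZMod p)) (S := S)
    (A := fun _ : Fin (n + 1) => Rp p) fun i =>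
      { (f i).toRingHom with
        commutes' := fun r => by
          change f i (Polynomial.aeval (xe p (oneM p)) r) = Polynomial.aeval t r
          rw [← Polynomial.aeval_algHom_apply, ht] }
  exact ⟨F.restrictScalars (ZMod p), hF⟩

lemma source_algHom_ext (hp : p ≠ 0)
    {f g : (⨂[Polynomial (ZMod p)] (_ : Fin (n + 1)), Rp p) →ₐ[ZMod p] S}
    (h : ∀ i k, f (xSlot p hp n i k) = g (xSlot p hp n i k)) : f = g := by
  have key (i) : f.comp (sourceIncl p n i) = g.comp (sourceIncl p n i) :=
    Rp_algHom_ext hp (h i)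
  have : f.toRingHom = g.toRingHom :=
    piTensorProduct_ringHom_ext fun i a => DFunLike.congr_fun (key i) a
  exact AlgHom.ext fun z => DFunLike.congr_fun this z

end Source

section Target

variable {p n : ℕ}

/-- The inclusion of the factor `F_p[x^{1/p^∞}]` of the target. -/
noncomputable def targetInclX (p n : ℕ) : Rp p →ₐ[ZMod p] targetAlg p n :=
  singleAlgHom (R := ZMod p) (A := Bfac p n) none

/-- The inclusion of the `i`-th factor `F_p[y^{1/p^∞}]/(y)` of the target. -/
noncomputable def targetInclY (p n : ℕ) (i : Fin n) : Ap p →ₐ[ZMod p] targetAlg p n :=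
  singleAlgHom (R := ZMod p) (A := Bfac p n) (some i)

lemma ySlot_eq (hp : p ≠ 0) (i : Fin n) (k : ℕ) :
    ySlot p hp n i k = targetInclY p n i (ybar p (pinvM p hp k)) := rfl

lemma ySlot_zero (hp : p ≠ 0) (i : Fin n) : ySlot p hp n i 0 = 0 := by
  rw [ySlot_eq, ybar_pinvM_zero, map_zero]

lemma ySlot_succ_pow (hp : p ≠ 0) (i : Fin n) (k : ℕ) :
    ySlot p hp n i (k + 1) ^ p = ySlot p hp n i k := by
  rw [ySlot_eq, ← map_pow, ybar_pinvM_succ_pow, ySlot_eq]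

variable {S : Type*} [CommRing S] [Algebra (ZMod p) S]

lemma exists_target_algHom (f : Rp p →ₐ[ZMod p] S) (g : Fin n → Ap p →ₐ[ZMod p] S) :
    ∃ F : targetAlg p n →ₐ[ZMod p] S,
      (∀ a, F (targetInclX p n a) = f a) ∧ ∀ i a, F (targetInclY p n i a) = g i a := by
  obtain ⟨F, hF⟩ := exists_algHom_piTensorProduct (R := ZMod p) (S := S) (A := Bfac p n)
    fun o => match o with
      | none => f
      | some i => g i
  exact ⟨F, hF none, fun i => hF (some i)⟩

lemma target_algHom_ext (hp : p ≠ 0) {f g : targetAlg p n →ₐ[ZMod p] S}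
    (hX : ∀ k, f (targetInclX p n (xe p (pinvM p hp k))) =
      g (targetInclX p n (xe p (pinvM p hp k))))
    (hY : ∀ i k, f (ySlot p hp n i k) = g (ySlot p hp n i k)) : f = g := by
  have keyX : f.comp (targetInclX p n) = g.comp (targetInclX p n) := Rp_algHom_ext hp hX
  have keyY (i) : f.comp (targetInclY p n i) = g.comp (targetInclY p n i) :=
    Ap_algHom_ext hp (hY i)
  have : f.toRingHom = g.toRingHom := piTensorProduct_ringHom_ext fun o a =>
    match o, a with
    | none, a => DFunLike.congr_fun keyX a
    | some i, a => DFunLike.congr_fun (keyY i) a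
  exact AlgHom.ext fun z => DFunLike.congr_fun this z

end Target

/-- for every `n ≥ 1` there is an `F_p`-algebra isomorphism from the
`(n+1)`-fold tensor product `F_p[x^{1/p^∞}] ⊗_{F_p[x]} ⋯ ⊗_{F_p[x]} F_p[x^{1/p^∞}]` to
`F_p[x^{1/p^∞}] ⊗_{F_p} (F_p[y^{1/p^∞}]/(y))^{⊗_{F_p} n}`, under which
`x_i^{1/p^k} − x_{i+1}^{1/p^k}` corresponds to `1 ⊗ ȳ^{1/p^k}` placed in the `i`-th
quotient factor (`1 ≤ i ≤ n`, `k ∈ ℕ`). -/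
theorem statement5 (p : ℕ) (hp : p.Prime) (n : ℕ) (hn : 1 ≤ n) :
    ∃ Φ : (⨂[Polynomial (ZMod p)] (_ : Fin (n + 1)), Rp p) ≃ₐ[ZMod p] targetAlg p n,
      ∀ (i : Fin n) (k : ℕ),
        Φ (xSlot p hp.ne_zero n i.castSucc k - xSlot p hp.ne_zero n i.succ k)
          = ySlot p hp.ne_zero n i k := by
  have hp0 := hp.ne_zero
  let b : Fin (n + 1) → ℕ → targetAlg p n := fun i k =>
    targetInclX p n (xe p (pinvM p hp0 k)) - Fin.partialSum (fun j => ySlot p hp0 n j k) i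
  have b_zero (k) : b 0 k = targetInclX p n (xe p (pinvM p hp0 k)) := by simp [b]
  have b_succ (i : Fin n) (k) : b i.succ k = b i.castSucc k - ySlot p hp0 n i k := by
    simp only [b, Fin.partialSum_succ]
    abel
  have b_pow (i k) : b i (k + 1) ^ p = b i k := by
    induction i using Fin.induction with
    | zero => rw [b_zero, b_zero, ← map_pow, xe_pinvM_succ_pow]
    | succ i ih => rw [b_succ, b_succ, sub_pow_of_zmod_algebra hp, ih, ySlot_succ_pow]
  have b_one (i) : b i 0 = b 0 0 := by
    induction i using Fin.induction with
    | zero => rfl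
    | succ i ih => rw [b_succ, ySlot_zero, sub_zero, ih]
  choose f hf using fun i => exists_Rp_algHom hp0 (b i) (b_pow i)
  obtain ⟨Φ, hΦ⟩ := exists_source_algHom f (b 0 0) fun i => by
    rw [← pinvM_zero hp0, hf, b_one]
  have hΦx (i k) : Φ (xSlot p hp0 n i k) = b i k := by rw [xSlot_eq, hΦ, hf]
  choose g hg using fun i : Fin n => exists_Ap_algHom hp0
    (fun k => xSlot p hp0 n i.castSucc k - xSlot p hp0 n i.succ k)
    (fun k => by rw [sub_pow_of_zmod_algebra hp, xSlot_succ_pow, xSlot_succ_pow])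
    (sub_eq_zero.mpr (xSlot_zero_eq hp0 _ _))
  obtain ⟨Ψ, hΨX, hΨY⟩ := exists_target_algHom (sourceIncl p n 0) g
  have hΨy (i k) : Ψ (ySlot p hp0 n i k) =
      xSlot p hp0 n i.castSucc k - xSlot p hp0 n i.succ k := by rw [ySlot_eq, hΨY, hg]
  have hΨb (i k) : Ψ (b i k) = xSlot p hp0 n i k := by
    induction i using Fin.induction with
    | zero => rw [b_zero, hΨX, xSlot_eq]
    | succ i ih => rw [b_succ, map_sub, ih, hΨy, sub_sub_cancel]
  have hΦsub (i : Fin n) (k) :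
      Φ (xSlot p hp0 n i.castSucc k - xSlot p hp0 n i.succ k) = ySlot p hp0 n i k := by
    rw [map_sub, hΦx, hΦx, b_succ, sub_sub_cancel]
  refine ⟨AlgEquiv.ofAlgHom Φ Ψ ?_ ?_, hΦsub⟩
  · refine target_algHom_ext hp0 (fun k => ?_) fun i k => ?_
    · rw [AlgHom.comp_apply, hΨX, ← xSlot_eq, hΦx, b_zero, AlgHom.id_apply]
    · rw [AlgHom.comp_apply, hΨy, hΦsub, AlgHom.id_apply]
  · refine source_algHom_ext hp0 fun i k => ?_
    rw [AlgHom.comp_apply, hΦx, hΨb, AlgHom.id_apply]
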